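/- arXiv:2011.08764 — 11 statements merged into one kernel-verified Lean document; each statement's English description precedes it below -/
import Mathlib

section
/- Let (x,y) ∈ Δ and fix an index i. Then: (a) if yᵢ = 0, the y-component of the vector field satisfies Fʸᵢ(x,y) = (γ + r·Σⱼ Aᵢⱼ yⱼ)·(1 − xᵢ) ≥ 0; (b) if xᵢ = 0, then Fˣᵢ(x,y) = (γ + r·Σⱼ Aᵢⱼ xⱼ)·(1 − yᵢ) ≥ 0; (c) if xᵢ + yᵢ = 1, then Fˣᵢ(x,y) = −xᵢ·(α + σ·Σⱼ Aᵢⱼ yⱼ) ≤ 0 and Fʸᵢ(x,y) = −yᵢ·(α + σ·Σⱼ Aᵢⱼ xⱼ) ≤ 0. In other words, at every boundary point of Δ the vector field points into Δ. -/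
/-- At every boundary point of the feasible set Δ, the vector field of the
networked dynamics points into Δ. -/
theorem boundary_vector_field_points_inward
    (γ r α σ : ℝ) (hγ : 0 < γ) (hr : 0 < r) (hα : 0 < α) (hσ : 0 < σ)
    (n d : ℕ) (hn : 1 ≤ n) (hd : 1 ≤ d)
    (A : Matrix (Fin n) (Fin n) ℝ)
    (hsym : A.IsSymm)
    (h01 : ∀ i j, A i j = 0 ∨ A i j = 1)
    (hdiag : ∀ i, A i i = 0)
    (hrow : ∀ i, ∑ j, A i j = (d : ℝ))
    (x y : Fin n → ℝ)
    (hΔ : ∀ i, 0 ≤ x i ∧ 0 ≤ y i ∧ x i + y i ≤ 1)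
    (i : Fin n) :
    (y i = 0 →
      (γ + r * ∑ j, A i j * y j) * (1 - x i - y i)
          - y i * (α + σ * ∑ j, A i j * x j)
        = (γ + r * ∑ j, A i j * y j) * (1 - x i) ∧
      0 ≤ (γ + r * ∑ j, A i j * y j) * (1 - x i - y i)
          - y i * (α + σ * ∑ j, A i j * x j)) ∧
    (x i = 0 →
      (γ + r * ∑ j, A i j * x j) * (1 - x i - y i)
          - x i * (α + σ * ∑ j, A i j * y j)
        = (γ + r * ∑ j, A i j * x j) * (1 - y i) ∧
      0 ≤ (γ + r * ∑ j, A i j * x j) * (1 - x i - y i)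
          - x i * (α + σ * ∑ j, A i j * y j)) ∧
    (x i + y i = 1 →
      ((γ + r * ∑ j, A i j * x j) * (1 - x i - y i)
          - x i * (α + σ * ∑ j, A i j * y j)
        = -(x i * (α + σ * ∑ j, A i j * y j)) ∧
       (γ + r * ∑ j, A i j * x j) * (1 - x i - y i)
          - x i * (α + σ * ∑ j, A i j * y j) ≤ 0) ∧
      ((γ + r * ∑ j, A i j * y j) * (1 - x i - y i)
          - y i * (α + σ * ∑ j, A i j * x j)
        = -(y i * (α + σ * ∑ j, A i j * x j)) ∧
       (γ + r * ∑ j, A i j * y j) * (1 - x i - y i)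
          - y i * (α + σ * ∑ j, A i j * x j) ≤ 0)) := by
  have hA : ∀ j, 0 ≤ A i j := fun j => by
    rcases h01 i j with h | h <;> rw [h] <;> norm_num
  have hX : 0 ≤ ∑ j, A i j * x j :=
    Finset.sum_nonneg fun j _ => mul_nonneg (hA j) (hΔ j).1
  have hY : 0 ≤ ∑ j, A i j * y j :=
    Finset.sum_nonneg fun j _ => mul_nonneg (hA j) (hΔ j).2.1
  obtain ⟨hx, hy, hxy⟩ := hΔ i
  generalize (∑ j, A i j * x j) = X at *
  generalize (∑ j, A i j * y j) = Y at *
  have gX : 0 ≤ γ + r * X := by positivity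
  have gY : 0 ≤ γ + r * Y := by positivity
  have aX : 0 ≤ y i * (α + σ * X) := by positivity
  have aY : 0 ≤ x i * (α + σ * Y) := by positivity
  have hs : 0 ≤ 1 - x i - y i := by linarith
  refine ⟨fun h => ⟨?_, ?_⟩, fun h => ⟨?_, ?_⟩, fun h => ?_⟩
  · rw [h]; ring
  · have := mul_nonneg gY hs
    have h0 : y i * (α + σ * X) = 0 := by rw [h]; ring
    linarith
  · rw [h]; ring
  · have := mul_nonneg gX hs
    have h0 : x i * (α + σ * Y) = 0 := by rw [h]; ring
    linarith
  · have h0 : 1 - x i - y i = 0 := by linarith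
    rw [h0]
    refine ⟨⟨by ring, by linarith⟩, ⟨by ring, by linarith⟩⟩
end

section
/- The set Δ is positively invariant for the networked dynamics: if (x,y) : [0,T] → ℝⁿ × ℝⁿ is a differentiable function satisfying x'ᵢ(t) = Fˣᵢ(x(t),y(t)) and y'ᵢ(t) = Fʸᵢ(x(t),y(t)) for all t ∈ [0,T] and all i, and (x(0),y(0)) ∈ Δ, then (x(t),y(t)) ∈ Δ for all t ∈ [0,T]. -/
/-- First-exit-time lemma. -/
lemma first_exit {ι : Type*} [Finite ι] (T : ℝ) (f f' : ι → ℝ → ℝ)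
    (hf : ∀ k, ∀ t ∈ Set.Icc (0 : ℝ) T, HasDerivAt (f k) (f' k t) t)
    (h0 : ∀ k, 0 < f k 0)
    (hb : ∀ t ∈ Set.Icc (0 : ℝ) T, (∀ k, 0 ≤ f k t) → ∀ k, f k t = 0 → 0 < f' k t) :
    ∀ t ∈ Set.Icc (0 : ℝ) T, ∀ k, 0 < f k t := by
  by_contra! hcon
  obtain ⟨t1, ht1, k1, hk1⟩ := hcon
  set S : Set ℝ := ⋃ k, (Set.Icc (0 : ℝ) T ∩ f k ⁻¹' Set.Iic 0) with hS
  have hclosed : IsClosed S := by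
    refine isClosed_iUnion_of_finite fun k => ?_
    exact ContinuousOn.preimage_isClosed_of_isClosed
      (fun t ht => (hf k t ht).continuousAt.continuousWithinAt) isClosed_Icc isClosed_Iic
  have hsub : S ⊆ Set.Icc 0 T := Set.iUnion_subset fun k => Set.inter_subset_left
  have hcomp : IsCompact S := isCompact_Icc.of_isClosed_subset hclosed hsub
  obtain ⟨t0, ht0S, hmin⟩ := hcomp.exists_isLeast ⟨t1, Set.mem_iUnion.2 ⟨k1, ht1, hk1⟩⟩
  have ht0 := hsub ht0S
  obtain ⟨k, -, hk⟩ := Set.mem_iUnion.1 ht0S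
  have hk : f k t0 ≤ 0 := hk
  have hpos : 0 < t0 := by
    rcases ht0.1.eq_or_lt with h | h
    · rw [← h] at hk
      exact absurd (h0 k) (not_lt.2 hk)
    · exact h
  have hbefore : ∀ᶠ s in nhdsWithin t0 (Set.Iio t0), ∀ j, 0 < f j s := by
    filter_upwards [Ioo_mem_nhdsLT hpos] with s hs j
    by_contra! h
    have := hmin (Set.mem_iUnion.2 ⟨j, ⟨hs.1.le, hs.2.le.trans ht0.2⟩, h⟩)
    exact absurd hs.2 (not_lt.2 this)
  have hnn : ∀ j, 0 ≤ f j t0 := fun j =>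
    ge_of_tendsto ((hf j t0 ht0).continuousAt.tendsto.mono_left nhdsWithin_le_nhds)
      (hbefore.mono fun s hs => (hs j).le)
  have hk0 : f k t0 = 0 := le_antisymm hk (hnn k)
  have hd := hb t0 ht0 hnn k hk0
  have hsl := (hasDerivAt_iff_tendsto_slope.1 (hf k t0 ht0)).mono_left
    (nhdsWithin_mono t0 (fun s (hs : s < t0) => hs.ne) :
      nhdsWithin t0 (Set.Iio t0) ≤ nhdsWithin t0 {t0}ᶜ)
  have hev := hsl.eventually (lt_mem_nhds hd)
  obtain ⟨s, ⟨hs1, hs2⟩, hs3⟩ :=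
    ((hev.and hbefore).and (self_mem_nhdsWithin : Set.Iio t0 ∈ _)).exists
  have hs3 : s < t0 := hs3
  have h2 := hs2 k
  rw [slope_def_field, hk0] at hs1
  have : (f k s - 0) / (s - t0) < 0 := div_neg_of_pos_of_neg (by linarith) (by linarith)
  linarith

lemma mul_lower {a b δ M : ℝ} (hδ : 0 < δ) (hδ1 : δ ≤ 1) (ha : -δ ≤ a) (hb : -δ ≤ b)
    (haM : |a| ≤ M) (hbM : |b| ≤ M) : -(δ * (2 * M + 1)) ≤ a * b := by
  have h1 := (abs_le.1 haM).2
  have h2 := (abs_le.1 hbM).2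
  nlinarith [mul_nonneg (by linarith : 0 ≤ a + δ) (by linarith : 0 ≤ b + δ),
    mul_nonneg hδ.le (by linarith : 0 ≤ M - a), mul_nonneg hδ.le (by linarith : 0 ≤ M - b),
    mul_nonneg hδ.le (by linarith : 0 ≤ 1 - δ)]

lemma sum_lower {n : ℕ} {a g : Fin n → ℝ} {d c : ℝ} (ha : ∀ j, 0 ≤ a j)
    (hd : ∑ j, a j = d) (hg : ∀ j, c ≤ g j) : d * c ≤ ∑ j, a j * g j := by
  rw [← hd, Finset.sum_mul]
  exact Finset.sum_le_sum fun j _ => mul_le_mul_of_nonneg_left (hg j) (ha j)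

lemma x_bound {n : ℕ} {a u v : Fin n → ℝ} {γ r α σ d δ M K p z : ℝ}
    (hγ : 0 < γ) (hr : 0 < r) (hα : 0 < α) (hσ : 0 < σ)
    (ha : ∀ j, 0 ≤ a j) (hd : ∑ j, a j = d) (hδ : 0 < δ) (hδ1 : δ ≤ 1)
    (hu : ∀ j, -δ ≤ u j) (huM : ∀ j, |u j| ≤ M) (hvM : ∀ j, |v j| ≤ M)
    (hz : -δ ≤ z) (hzM : |z| ≤ M) (hp : p = -δ)
    (hK : γ + r * (d * (2 * M + 1)) + σ * (d * M) < K) :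
    0 < (γ + r * ∑ j, a j * u j) * z - p * (α + σ * ∑ j, a j * v j) + K * δ := by
  have h1 : d * -(δ * (2 * M + 1)) ≤ ∑ j, a j * (u j * z) :=
    sum_lower ha hd fun j => mul_lower hδ hδ1 (hu j) hz (huM j) hzM
  have h1' : ∑ j, a j * (u j * z) = (∑ j, a j * u j) * z := by
    rw [Finset.sum_mul]; exact Finset.sum_congr rfl fun j _ => by ring
  have h2 : d * -M ≤ ∑ j, a j * v j := sum_lower ha hd fun j => (abs_le.1 (hvM j)).1
  rw [h1'] at h1
  subst hp
  have e1 := mul_le_mul_of_nonneg_left h1 hr.le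
  have e2 := mul_le_mul_of_nonneg_left h2 (mul_pos hδ hσ).le
  have e3 := mul_le_mul_of_nonneg_left hz hγ.le
  have e4 := mul_lt_mul_of_pos_left hK hδ
  have e5 := mul_pos hδ hα
  nlinarith

lemma z_bound {n : ℕ} {a u v : Fin n → ℝ} {γ r α σ d δ M K p q : ℝ}
    (hγ : 0 < γ) (hr : 0 < r) (hα : 0 < α) (hσ : 0 < σ)
    (ha : ∀ j, 0 ≤ a j) (hd : ∑ j, a j = d) (hδ : 0 < δ) (hδ1 : δ ≤ 1)
    (hu : ∀ j, -δ ≤ u j) (hv : ∀ j, -δ ≤ v j) (huM : ∀ j, |u j| ≤ M) (hvM : ∀ j, |v j| ≤ M)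
    (hp : -δ ≤ p) (hq : -δ ≤ q) (hpM : |p| ≤ M) (hqM : |q| ≤ M)
    (hz : 1 - p - q = -δ)
    (hK : 2 * (r * (d * M)) + 2 * (σ * (d * (2 * M + 1))) < K) :
    0 < -((γ + r * ∑ j, a j * u j) * (1 - p - q) - p * (α + σ * ∑ j, a j * v j))
      - ((γ + r * ∑ j, a j * v j) * (1 - p - q) - q * (α + σ * ∑ j, a j * u j)) + K * δ := by
  have h1 : d * -(δ * (2 * M + 1)) ≤ ∑ j, a j * (v j * p) :=
    sum_lower ha hd fun j => mul_lower hδ hδ1 (hv j) hp (hvM j) hpM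
  have h1' : ∑ j, a j * (v j * p) = (∑ j, a j * v j) * p := by
    rw [Finset.sum_mul]; exact Finset.sum_congr rfl fun j _ => by ring
  have h2 : d * -(δ * (2 * M + 1)) ≤ ∑ j, a j * (u j * q) :=
    sum_lower ha hd fun j => mul_lower hδ hδ1 (hu j) hq (huM j) hqM
  have h2' : ∑ j, a j * (u j * q) = (∑ j, a j * u j) * q := by
    rw [Finset.sum_mul]; exact Finset.sum_congr rfl fun j _ => by ring
  have h3 : d * -M ≤ ∑ j, a j * v j := sum_lower ha hd fun j => (abs_le.1 (hvM j)).1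
  have h4 : d * -M ≤ ∑ j, a j * u j := sum_lower ha hd fun j => (abs_le.1 (huM j)).1
  rw [h1'] at h1
  rw [h2'] at h2
  rw [hz]
  have e1 := mul_le_mul_of_nonneg_left h1 hσ.le
  have e2 := mul_le_mul_of_nonneg_left h2 hσ.le
  have e3 := mul_le_mul_of_nonneg_left h3 (mul_pos hδ hr).le
  have e4 := mul_le_mul_of_nonneg_left h4 (mul_pos hδ hr).le
  have e5 := mul_lt_mul_of_pos_left hK hδ
  have e6 := mul_pos hδ hγ
  have e7 : 0 < α * (p + q) := mul_pos hα (by linarith)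
  nlinarith

/-- The feasible set Δ is positively invariant for the networked dynamics. -/
theorem Delta_positively_invariant
    (γ r α σ : ℝ) (hγ : 0 < γ) (hr : 0 < r) (hα : 0 < α) (hσ : 0 < σ)
    (n d : ℕ) (hn : 1 ≤ n) (hd : 1 ≤ d)
    (A : Matrix (Fin n) (Fin n) ℝ)
    (hsym : A.IsSymm)
    (h01 : ∀ i j, A i j = 0 ∨ A i j = 1)
    (hdiag : ∀ i, A i i = 0)
    (hrow : ∀ i, ∑ j, A i j = (d : ℝ))
    (T : ℝ) (hT : 0 ≤ T)
    (x y : ℝ → Fin n → ℝ)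
    (hx : ∀ t ∈ Set.Icc (0 : ℝ) T, ∀ i, HasDerivAt (fun s => x s i)
      ((γ + r * ∑ j, A i j * x t j) * (1 - x t i - y t i)
        - x t i * (α + σ * ∑ j, A i j * y t j)) t)
    (hy : ∀ t ∈ Set.Icc (0 : ℝ) T, ∀ i, HasDerivAt (fun s => y s i)
      ((γ + r * ∑ j, A i j * y t j) * (1 - x t i - y t i)
        - y t i * (α + σ * ∑ j, A i j * x t j)) t)
    (h0 : ∀ i, 0 ≤ x 0 i ∧ 0 ≤ y 0 i ∧ x 0 i + y 0 i ≤ 1) :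
    ∀ t ∈ Set.Icc (0 : ℝ) T, ∀ i, 0 ≤ x t i ∧ 0 ≤ y t i ∧ x t i + y t i ≤ 1 := by
  have hA : ∀ i j, 0 ≤ A i j := fun i j => by rcases h01 i j with h | h <;> rw [h] <;> norm_num
  have hxc : ContinuousOn x (Set.Icc 0 T) := continuousOn_pi.2 fun i t ht =>
    (hx t ht i).continuousAt.continuousWithinAt
  have hyc : ContinuousOn y (Set.Icc 0 T) := continuousOn_pi.2 fun i t ht =>
    (hy t ht i).continuousAt.continuousWithinAt
  obtain ⟨C1, hC1⟩ := isCompact_Icc.exists_bound_of_continuousOn hxc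
  obtain ⟨C2, hC2⟩ := isCompact_Icc.exists_bound_of_continuousOn hyc
  have hC1n : 0 ≤ C1 := (norm_nonneg _).trans (hC1 0 ⟨le_rfl, hT⟩)
  have hC2n : 0 ≤ C2 := (norm_nonneg _).trans (hC2 0 ⟨le_rfl, hT⟩)
  obtain ⟨M, hM⟩ : ∃ M, M = 1 + C1 + C2 := ⟨_, rfl⟩
  have hx1 : ∀ t ∈ Set.Icc (0 : ℝ) T, ∀ i, |x t i| ≤ C1 := fun t ht i =>
    (norm_le_pi_norm (x t) i).trans (hC1 t ht)
  have hy1 : ∀ t ∈ Set.Icc (0 : ℝ) T, ∀ i, |y t i| ≤ C2 := fun t ht i =>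
    (norm_le_pi_norm (y t) i).trans (hC2 t ht)
  have hxM : ∀ t ∈ Set.Icc (0 : ℝ) T, ∀ i, |x t i| ≤ M := fun t ht i => by
    linarith [hx1 t ht i]
  have hyM : ∀ t ∈ Set.Icc (0 : ℝ) T, ∀ i, |y t i| ≤ M := fun t ht i => by
    linarith [hy1 t ht i]
  have hzM : ∀ t ∈ Set.Icc (0 : ℝ) T, ∀ i, |1 - x t i - y t i| ≤ M := fun t ht i => by
    have a := abs_le.1 (hx1 t ht i)
    have b := abs_le.1 (hy1 t ht i)
    exact abs_le.2 ⟨by linarith [a.1, a.2, b.1, b.2], by linarith [a.1, a.2, b.1, b.2]⟩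
  have hM0 : 0 ≤ M := by linarith
  have hd0 : (0 : ℝ) ≤ d := Nat.cast_nonneg d
  obtain ⟨K, hK⟩ : ∃ K, K = 1 + (γ + r * (d * (2 * M + 1)) + σ * (d * M)) +
    (2 * (r * (d * M)) + 2 * (σ * (d * (2 * M + 1)))) := ⟨_, rfl⟩
  have hp1 : 0 ≤ γ + r * (d * (2 * M + 1)) + σ * (d * M) := by positivity
  have hp2 : 0 ≤ 2 * (r * (d * M)) + 2 * (σ * (d * (2 * M + 1))) := by positivity
  have hK1 : γ + r * (d * (2 * M + 1)) + σ * (d * M) < K := by linarith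
  have hK2 : 2 * (r * (d * M)) + 2 * (σ * (d * (2 * M + 1))) < K := by linarith
  have hK0 : 0 < K := by linarith
  -- the perturbed claim
  have key : ∀ ε : ℝ, 0 < ε → ε * Real.exp (K * T) ≤ 1 → ∀ t ∈ Set.Icc (0 : ℝ) T, ∀ i,
      0 < x t i + ε * Real.exp (K * t) ∧ 0 < y t i + ε * Real.exp (K * t) ∧
      0 < 1 - x t i - y t i + ε * Real.exp (K * t) := by
    intro ε hε hε1
    have hE : ∀ t, HasDerivAt (fun s => ε * Real.exp (K * s)) (K * (ε * Real.exp (K * t))) t := by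
      intro t
      have := (((hasDerivAt_id t).const_mul K).exp).const_mul ε
      refine this.congr_deriv ?_
      simp only [id]
      ring
    let dx : Fin n → ℝ → ℝ := fun i t => (γ + r * ∑ j, A i j * x t j) * (1 - x t i - y t i)
        - x t i * (α + σ * ∑ j, A i j * y t j)
    let dy : Fin n → ℝ → ℝ := fun i t => (γ + r * ∑ j, A i j * y t j) * (1 - x t i - y t i)
        - y t i * (α + σ * ∑ j, A i j * x t j)
    let f : Fin n ⊕ Fin n ⊕ Fin n → ℝ → ℝ := Sum.elim
      (fun i t => x t i + ε * Real.exp (K * t)) (Sum.elim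
      (fun i t => y t i + ε * Real.exp (K * t))
      (fun i t => 1 - x t i - y t i + ε * Real.exp (K * t)))
    let f' : Fin n ⊕ Fin n ⊕ Fin n → ℝ → ℝ := Sum.elim
      (fun i t => dx i t + K * (ε * Real.exp (K * t))) (Sum.elim
      (fun i t => dy i t + K * (ε * Real.exp (K * t)))
      (fun i t => - dx i t - dy i t + K * (ε * Real.exp (K * t))))
    have main := first_exit T f f' ?_ ?_ ?_
    · intro t ht i
      exact ⟨main t ht (Sum.inl i), main t ht (Sum.inr (Sum.inl i)),
        main t ht (Sum.inr (Sum.inr i))⟩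
    · rintro (i | i | i) t ht
      · exact (hx t ht i).add (hE t)
      · exact (hy t ht i).add (hE t)
      · exact (((hx t ht i).const_sub 1).sub (hy t ht i)).add (hE t)
    · rintro (i | i | i)
      · have := (h0 i).1
        simp only [f, Sum.elim_inl]
        positivity
      · have := (h0 i).2.1
        simp only [f, Sum.elim_inl, Sum.elim_inr]
        positivity
      · have := (h0 i).2.2
        have h2 : 0 < ε * Real.exp (K * 0) := by positivity
        simp only [f, Sum.elim_inr]
        linarith
    · intro t ht hall
      have hδ : 0 < ε * Real.exp (K * t) := by positivity
      have hδ1 : ε * Real.exp (K * t) ≤ 1 := by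
        refine le_trans (mul_le_mul_of_nonneg_left ?_ hε.le) hε1
        exact Real.exp_le_exp.2 (mul_le_mul_of_nonneg_left ht.2 hK0.le)
      have hxl : ∀ i, -(ε * Real.exp (K * t)) ≤ x t i := fun i => by
        have : 0 ≤ x t i + ε * Real.exp (K * t) := hall (Sum.inl i)
        linarith
      have hyl : ∀ i, -(ε * Real.exp (K * t)) ≤ y t i := fun i => by
        have : 0 ≤ y t i + ε * Real.exp (K * t) := hall (Sum.inr (Sum.inl i))
        linarith
      have hzl : ∀ i, -(ε * Real.exp (K * t)) ≤ 1 - x t i - y t i := fun i => by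
        have : 0 ≤ 1 - x t i - y t i + ε * Real.exp (K * t) := hall (Sum.inr (Sum.inr i))
        linarith
      rintro (i | i | i) hk
      · have hk : x t i + ε * Real.exp (K * t) = 0 := hk
        exact x_bound hγ hr hα hσ (hA i) (hrow i) hδ hδ1 hxl (hxM t ht) (hyM t ht) (hzl i)
          (hzM t ht i) (by linarith) hK1
      · have hk : y t i + ε * Real.exp (K * t) = 0 := hk
        exact x_bound hγ hr hα hσ (hA i) (hrow i) hδ hδ1 hyl (hyM t ht) (hxM t ht) (hzl i)
          (hzM t ht i) (by linarith) hK1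
      · have hk : 1 - x t i - y t i + ε * Real.exp (K * t) = 0 := hk
        exact z_bound hγ hr hα hσ (hA i) (hrow i) hδ hδ1 hxl hyl (hxM t ht) (hyM t ht)
          (hxl i) (hyl i) (hxM t ht i) (hyM t ht i) (by linarith) hK2
  -- let ε tend to 0
  intro t ht i
  have lim : ∀ c : ℝ, (∀ ε : ℝ, 0 < ε → ε * Real.exp (K * T) ≤ 1 →
      0 < c + ε * Real.exp (K * t)) → 0 ≤ c := by
    intro c hc
    have h1 : Filter.Tendsto (fun ε : ℝ => c + ε * Real.exp (K * t))
        (nhdsWithin 0 (Set.Ioi 0)) (nhds c) := by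
      have : Continuous (fun ε : ℝ => c + ε * Real.exp (K * t)) := by fun_prop
      have h := this.tendsto 0
      simp only [zero_mul, add_zero] at h
      exact h.mono_left nhdsWithin_le_nhds
    refine ge_of_tendsto h1 ?_
    have hpos : 0 < 1 / Real.exp (K * T) := by positivity
    filter_upwards [Ioo_mem_nhdsGT hpos] with ε hε
    refine (hc ε hε.1 ?_).le
    exact ((lt_div_iff₀ (Real.exp_pos _)).1 hε.2).le
  refine ⟨lim _ fun ε h1 h2 => (key ε h1 h2 t ht i).1,
    lim _ fun ε h1 h2 => (key ε h1 h2 t ht i).2.1, ?_⟩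
  have := lim _ fun ε h1 h2 => (key ε h1 h2 t ht i).2.2
  linarith
end

section
/- Define ξ = ( −(2γ − r·d + α) + √((2γ − r·d + α)² + 4γ·d·(2r + σ)) ) / (2·d·(2r + σ)). Then the symmetric consensus state in which xᵢ = ξ and yᵢ = ξ for every i is an equilibrium of the networked dynamics, i.e., Fˣᵢ(ξ·𝟙, ξ·𝟙) = 0 and Fʸᵢ(ξ·𝟙, ξ·𝟙) = 0 for all i, where 𝟙 ∈ ℝⁿ is the all-ones vector. -/
/-- The symmetric consensus state with common value ξ is an equilibrium of the
networked dynamics. -/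
theorem symmetric_consensus_equilibrium
    (γ r α σ : ℝ) (hγ : 0 < γ) (hr : 0 < r) (hα : 0 < α) (hσ : 0 < σ)
    (n d : ℕ) (hn : 1 ≤ n) (hd : 1 ≤ d)
    (A : Matrix (Fin n) (Fin n) ℝ)
    (hsym : A.IsSymm)
    (h01 : ∀ i j, A i j = 0 ∨ A i j = 1)
    (hdiag : ∀ i, A i i = 0)
    (hrow : ∀ i, ∑ j, A i j = (d : ℝ))
    (ξ : ℝ)
    (hξ : ξ = (-(2 * γ - r * d + α)
        + Real.sqrt ((2 * γ - r * d + α) ^ 2 + 4 * γ * d * (2 * r + σ)))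
        / (2 * d * (2 * r + σ))) :
    ∀ i : Fin n,
      (γ + r * ∑ j, A i j * ξ) * (1 - ξ - ξ) - ξ * (α + σ * ∑ j, A i j * ξ) = 0 ∧
      (γ + r * ∑ j, A i j * ξ) * (1 - ξ - ξ) - ξ * (α + σ * ∑ j, A i j * ξ) = 0 := by
  intro i
  have hd0 : (0 : ℝ) < d := by exact_mod_cast hd
  have ha : 0 < (d : ℝ) * (2 * r + σ) := by positivity
  have hdisc : 0 ≤ (2 * γ - r * d + α) ^ 2 + 4 * γ * d * (2 * r + σ) := by positivity
  have hs := Real.sq_sqrt hdisc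
  set s := Real.sqrt ((2 * γ - r * d + α) ^ 2 + 4 * γ * d * (2 * r + σ)) with hsdef
  have ha2 : 2 * (d : ℝ) * (2 * r + σ) ≠ 0 := by positivity
  have hlin : ξ * (2 * d * (2 * r + σ)) = -(2 * γ - r * d + α) + s := by
    rw [hξ]
    exact div_mul_cancel₀ _ ha2
  have hs2 : s = ξ * (2 * d * (2 * r + σ)) + (2 * γ - r * d + α) := by linarith
  rw [hs2] at hs
  rw [← Finset.sum_mul, hrow i]
  have key : (γ + r * (d * ξ)) * (1 - ξ - ξ) - ξ * (α + σ * (d * ξ)) = 0 := by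
    have h4 : (4 * ((d : ℝ) * (2 * r + σ))) *
        ((γ + r * (d * ξ)) * (1 - ξ - ξ) - ξ * (α + σ * (d * ξ))) = 0 := by
      linear_combination -hs
    rcases mul_eq_zero.mp h4 with h | h
    · linarith
    · exact h
  exact ⟨key, key⟩
end

section
/- Suppose ξ ∈ ℝ is a real root of the quadratic d·X² + (α/r − d)·X + (γ·α)/(r·d·σ) = 0, and set μ = 1 − ξ − α/(r·d). Then the consensus state (ξ·𝟙, μ·𝟙) is an equilibrium of the networked dynamics: Fˣᵢ(ξ·𝟙, μ·𝟙) = 0 and Fʸᵢ(ξ·𝟙, μ·𝟙) = 0 for all i. -/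
/-- Case 2 consensus equilibria: if ξ is a root of dX² + (α/r − d)X + γα/(rdσ),
and μ = 1 − ξ − α/(rd), then (ξ𝟙, μ𝟙) is an equilibrium. -/
theorem case2_consensus_equilibrium
    (γ r α σ : ℝ) (hγ : 0 < γ) (hr : 0 < r) (hα : 0 < α) (hσ : 0 < σ)
    (n d : ℕ) (hn : 1 ≤ n) (hd : 1 ≤ d)
    (A : Matrix (Fin n) (Fin n) ℝ)
    (hsym : A.IsSymm)
    (h01 : ∀ i j, A i j = 0 ∨ A i j = 1)
    (hdiag : ∀ i, A i i = 0)
    (hrow : ∀ i, ∑ j, A i j = (d : ℝ))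
    (ξ μ : ℝ)
    (hroot : d * ξ ^ 2 + (α / r - d) * ξ + (γ * α) / (r * d * σ) = 0)
    (hμ : μ = 1 - ξ - α / (r * d)) :
    ∀ i : Fin n,
      (γ + r * ∑ j, A i j * ξ) * (1 - ξ - μ) - ξ * (α + σ * ∑ j, A i j * μ) = 0 ∧
      (γ + r * ∑ j, A i j * μ) * (1 - ξ - μ) - μ * (α + σ * ∑ j, A i j * ξ) = 0 := by
  intro i
  have hd' : (0 : ℝ) < d := by exact_mod_cast hd
  rw [← Finset.sum_mul, ← Finset.sum_mul, hrow i]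
  obtain ⟨s, hs⟩ : ∃ s, s = α / (r * d) := ⟨_, rfl⟩
  have hα' : α = r * d * s := by rw [hs]; field_simp
  have hμ' : μ = 1 - ξ - s := by rw [hμ, hs]
  have h1 : α / r = d * s := by rw [hα']; field_simp
  have h2 : (γ * α) / (r * d * σ) = γ * s / σ := by rw [hα']; field_simp
  rw [h1, h2] at hroot
  have h3 : γ * s - σ * d * ξ * μ = 0 := by
    have h4 : σ * (γ * s / σ) = γ * s := by field_simp
    rw [hμ']
    linear_combination σ * hroot - h4
  have h5 : 1 - ξ - μ = s := by rw [hμ']; ring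
  rw [h5, hα']
  constructor <;> linear_combination h3
end

section
/- Every consensus equilibrium is of one of two types: if ξ, μ ∈ ℝ are such that the consensus state (ξ·𝟙, μ·𝟙) is an equilibrium of the networked dynamics (Fˣᵢ(ξ·𝟙, μ·𝟙) = 0 and Fʸᵢ(ξ·𝟙, μ·𝟙) = 0 for all i), then either ξ = μ, or 1 − ξ − μ = α/(r·d). -/
/-- Every consensus equilibrium is symmetric (ξ = μ) or satisfies
1 − ξ − μ = α/(rd). -/
theorem consensus_equilibrium_dichotomy
    (γ r α σ : ℝ) (hγ : 0 < γ) (hr : 0 < r) (hα : 0 < α) (hσ : 0 < σ)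
    (n d : ℕ) (hn : 1 ≤ n) (hd : 1 ≤ d)
    (A : Matrix (Fin n) (Fin n) ℝ)
    (hsym : A.IsSymm)
    (h01 : ∀ i j, A i j = 0 ∨ A i j = 1)
    (hdiag : ∀ i, A i i = 0)
    (hrow : ∀ i, ∑ j, A i j = (d : ℝ))
    (ξ μ : ℝ)
    (heq : ∀ i : Fin n,
      (γ + r * ∑ j, A i j * ξ) * (1 - ξ - μ) - ξ * (α + σ * ∑ j, A i j * μ) = 0 ∧
      (γ + r * ∑ j, A i j * μ) * (1 - ξ - μ) - μ * (α + σ * ∑ j, A i j * ξ) = 0) :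
    ξ = μ ∨ 1 - ξ - μ = α / (r * d) := by
  obtain ⟨h1, h2⟩ := heq ⟨0, hn⟩
  simp only [← Finset.sum_mul, hrow] at h1 h2
  have hd' : (0 : ℝ) < d := by exact_mod_cast hd
  have key : (ξ - μ) * ((1 - ξ - μ) * (r * d) - α) = 0 := by linear_combination h1 - h2
  rcases mul_eq_zero.mp key with h | h
  · left; linarith
  · right
    rw [eq_div_iff (mul_pos hr hd').ne']
    linarith
end

section
/- Let ξ, μ ∈ ℝ with 0 ≤ ξ, 0 ≤ μ, ξ + μ ≤ 1, and set ζ = 1 − ξ − μ. Let J be the 2n×2n real block matrix J = [[ r·ζ·A − (γ + r·d·ξ + α + σ·d·μ)·I , −σ·ξ·A − (γ + r·d·ξ)·I ], [ −σ·μ·A − (γ + r·d·μ)·I , r·ζ·A − (γ + r·d·μ + α + σ·d·ξ)·I ]] (the Jacobian of the networked dynamics at the consensus state (ξ·𝟙, μ·𝟙)). If α + σ·d·μ > r·d·ζ + σ·d and α + σ·d·ξ > r·d·ζ + σ·d, then every complex eigenvalue of J has strictly negative real part. -/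
open Matrix

lemma row_bound_aux (n d : ℕ) (A : Matrix (Fin n) (Fin n) ℝ)
    (h01 : ∀ i j, A i j = 0 ∨ A i j = 1)
    (hrow : ∀ i, ∑ j, A i j = (d : ℝ)) (a b : ℝ) (i : Fin n) :
    ∑ j, ‖(((a • A - b • (1 : Matrix (Fin n) (Fin n) ℝ)) i j : ℝ) : ℂ)‖ ≤ |a| * d + |b| := by
  have key : ∀ j, ‖(((a • A - b • (1 : Matrix (Fin n) (Fin n) ℝ)) i j : ℝ) : ℂ)‖
      ≤ |a| * A i j + (if i = j then |b| else 0) := by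
    intro j
    have hA : 0 ≤ A i j := by rcases h01 i j with h | h <;> simp [h]
    rw [Complex.norm_real, Real.norm_eq_abs]
    simp only [Matrix.sub_apply, Matrix.smul_apply, smul_eq_mul, Matrix.one_apply]
    refine (abs_sub _ _).trans ?_
    rw [abs_mul, abs_mul, abs_of_nonneg hA]
    split_ifs <;> simp
  refine (Finset.sum_le_sum fun j _ => key j).trans ?_
  rw [Finset.sum_add_distrib, ← Finset.mul_sum, hrow]
  simp

/-- Gershgorin-type sufficient condition: the Jacobian of the networked dynamics
at a consensus state has all complex eigenvalues in the open left half-plane. -/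
theorem jacobian_eigenvalues_negative_real_part
    (γ r α σ : ℝ) (hγ : 0 < γ) (hr : 0 < r) (hα : 0 < α) (hσ : 0 < σ)
    (n d : ℕ) (hn : 1 ≤ n) (hd : 1 ≤ d)
    (A : Matrix (Fin n) (Fin n) ℝ)
    (hsym : A.IsSymm)
    (h01 : ∀ i j, A i j = 0 ∨ A i j = 1)
    (hdiag : ∀ i, A i i = 0)
    (hrow : ∀ i, ∑ j, A i j = (d : ℝ))
    (ξ μ : ℝ) (hξ0 : 0 ≤ ξ) (hμ0 : 0 ≤ μ) (hξμ : ξ + μ ≤ 1)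
    (ζ : ℝ) (hζ : ζ = 1 - ξ - μ)
    (J : Matrix (Fin n ⊕ Fin n) (Fin n ⊕ Fin n) ℝ)
    (hJ : J = Matrix.fromBlocks
      ((r * ζ) • A - (γ + r * d * ξ + α + σ * d * μ) • (1 : Matrix (Fin n) (Fin n) ℝ))
      ((-(σ * ξ)) • A - (γ + r * d * ξ) • (1 : Matrix (Fin n) (Fin n) ℝ))
      ((-(σ * μ)) • A - (γ + r * d * μ) • (1 : Matrix (Fin n) (Fin n) ℝ))
      ((r * ζ) • A - (γ + r * d * μ + α + σ * d * ξ) • (1 : Matrix (Fin n) (Fin n) ℝ)))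
    (h1 : r * d * ζ + σ * d < α + σ * d * μ)
    (h2 : r * d * ζ + σ * d < α + σ * d * ξ) :
    ∀ z ∈ spectrum ℂ (J.map (algebraMap ℝ ℂ)), z.re < 0 := by
  intro z hz
  have hev : Module.End.HasEigenvalue (Matrix.toLin' (J.map (algebraMap ℝ ℂ))) z := by
    rw [Module.End.hasEigenvalue_iff_mem_spectrum, Matrix.spectrum_toLin']
    exact hz
  obtain ⟨k, hk⟩ := eigenvalue_mem_ball hev
  rw [mem_closedBall_iff_norm] at hk
  have hsum := Finset.add_sum_erase Finset.univ
    (fun j => ‖(J.map (algebraMap ℝ ℂ)) k j‖) (Finset.mem_univ k)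
  have hre := (Complex.abs_re_le_norm _).trans hk
  have hre' := (le_abs_self _).trans hre
  have hd0 : (0 : ℝ) < d := by exact_mod_cast hd
  have hζ0 : 0 ≤ ζ := by linarith
  have hσd : 0 < σ * d := mul_pos hσ hd0
  have e1 : 0 ≤ σ * d * ξ := by positivity
  have e2 : 0 ≤ σ * d * μ := by positivity
  have e3 : σ * d * ξ ≤ σ * d := by nlinarith
  have e4 : σ * d * μ ≤ σ * d := by nlinarith
  have b1 := row_bound_aux n d A h01 hrow
  rcases k with i | i
  · have c1 := b1 (r * ζ) (γ + r * d * ξ + α + σ * d * μ) i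
    have c2 := b1 (-(σ * ξ)) (γ + r * d * ξ) i
    rw [Fintype.sum_sum_type] at hsum
    have hkk : J (Sum.inl i) (Sum.inl i) = -(γ + r * d * ξ + α + σ * d * μ) := by
      simp [hJ, hdiag]
    have hD : 0 ≤ γ + r * d * ξ + α + σ * d * μ := by positivity
    have hE : 0 ≤ γ + r * d * ξ := by positivity
    rw [abs_of_nonneg (by positivity), abs_of_nonneg hD] at c1
    rw [abs_neg, abs_of_nonneg (by positivity), abs_of_nonneg hE] at c2
    have hn : ‖(J.map (algebraMap ℝ ℂ)) (Sum.inl i) (Sum.inl i)‖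
        = γ + r * d * ξ + α + σ * d * μ := by
      rw [Matrix.map_apply, hkk, Complex.coe_algebraMap, Complex.norm_real, Real.norm_eq_abs,
        abs_neg, abs_of_nonneg hD]
    have s1 : ∑ j, ‖(J.map (algebraMap ℝ ℂ)) (Sum.inl i) (Sum.inl j)‖
        ≤ r * ζ * d + (γ + r * d * ξ + α + σ * d * μ) := by rw [hJ]; exact c1
    have s2 : ∑ j, ‖(J.map (algebraMap ℝ ℂ)) (Sum.inl i) (Sum.inr j)‖
        ≤ σ * ξ * d + (γ + r * d * ξ) := by rw [hJ]; exact c2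
    rw [hn] at hsum
    rw [Complex.sub_re, Matrix.map_apply, hkk] at hre'
    have hcre : ∀ x : ℝ, (algebraMap ℝ ℂ x).re = x := fun x => Complex.ofReal_re x
    rw [hcre] at hre'
    linarith
  · have c1 := b1 (r * ζ) (γ + r * d * μ + α + σ * d * ξ) i
    have c2 := b1 (-(σ * μ)) (γ + r * d * μ) i
    rw [Fintype.sum_sum_type] at hsum
    have hkk : J (Sum.inr i) (Sum.inr i) = -(γ + r * d * μ + α + σ * d * ξ) := by
      simp [hJ, hdiag]
    have hD : 0 ≤ γ + r * d * μ + α + σ * d * ξ := by positivity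
    have hE : 0 ≤ γ + r * d * μ := by positivity
    rw [abs_of_nonneg (by positivity), abs_of_nonneg hD] at c1
    rw [abs_neg, abs_of_nonneg (by positivity), abs_of_nonneg hE] at c2
    have hn : ‖(J.map (algebraMap ℝ ℂ)) (Sum.inr i) (Sum.inr i)‖
        = γ + r * d * μ + α + σ * d * ξ := by
      rw [Matrix.map_apply, hkk, Complex.coe_algebraMap, Complex.norm_real, Real.norm_eq_abs,
        abs_neg, abs_of_nonneg hD]
    have s1 : ∑ j, ‖(J.map (algebraMap ℝ ℂ)) (Sum.inr i) (Sum.inr j)‖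
        ≤ r * ζ * d + (γ + r * d * μ + α + σ * d * ξ) := by rw [hJ]; exact c1
    have s2 : ∑ j, ‖(J.map (algebraMap ℝ ℂ)) (Sum.inr i) (Sum.inl j)‖
        ≤ σ * μ * d + (γ + r * d * μ) := by rw [hJ]; exact c2
    rw [hn] at hsum
    rw [Complex.sub_re, Matrix.map_apply, hkk] at hre'
    have hcre : ∀ x : ℝ, (algebraMap ℝ ℂ x).re = x := fun x => Complex.ofReal_re x
    rw [hcre] at hre'
    linarith
end

section
/- Let Ψˣ, Ψʸ, Ψᶻ be nonnegative reals and let M be the 2n×2n real block matrix M = [[ −(γ + α)·I + (r·Ψᶻ/k_max)·A , −γ·I − (σ·Ψˣ/k_max)·A ], [ −γ·I − (σ·Ψʸ/k_max)·A , −(γ + α)·I + (r·Ψᶻ/k_max)·A ]]. If α > (r·Ψᶻ·d)/k_max + (σ·Ψˣ·d)/k_max and α > (σ·Ψʸ·d)/k_max + (r·Ψᶻ·d)/k_max, then every complex eigenvalue of M has strictly negative real part. -/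
open Matrix

lemma abs_row_le {n d : ℕ} (A : Matrix (Fin n) (Fin n) ℝ)
    (h01 : ∀ i j, A i j = 0 ∨ A i j = 1)
    (hrow : ∀ i, ∑ j, A i j = (d : ℝ)) (p q : ℝ) (i : Fin n) :
    ∑ j, |(p • (1 : Matrix (Fin n) (Fin n) ℝ) + q • A) i j| ≤ |p| + |q| * d := by
  have h : ∀ j, |(p • (1 : Matrix (Fin n) (Fin n) ℝ) + q • A) i j|
      ≤ |p| * (1 : Matrix (Fin n) (Fin n) ℝ) i j + |q| * A i j := by
    intro j
    simp only [Matrix.add_apply, Matrix.smul_apply, smul_eq_mul]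
    refine (abs_add_le _ _).trans ?_
    rw [abs_mul, abs_mul]
    have e1 : |(1 : Matrix (Fin n) (Fin n) ℝ) i j| = (1 : Matrix (Fin n) (Fin n) ℝ) i j := by
      by_cases hij : i = j <;> simp [Matrix.one_apply, hij]
    have e2 : |A i j| = A i j := by
      rcases h01 i j with h | h <;> simp [h]
    rw [e1, e2]
  refine (Finset.sum_le_sum fun j _ => h j).trans ?_
  rw [Finset.sum_add_distrib, ← Finset.mul_sum, ← Finset.mul_sum, hrow]
  simp [Matrix.one_apply]

/-- Sufficient condition for all complex eigenvalues of the aggregated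
first-moment system matrix of the structured networked multi-population
to have strictly negative real part. -/
theorem structured_system_matrix_stable
    (γ r α σ : ℝ) (hγ : 0 < γ) (hr : 0 < r) (hα : 0 < α) (hσ : 0 < σ)
    (n d kmax : ℕ) (hn : 1 ≤ n) (hd : 1 ≤ d) (hkmax : 1 ≤ kmax)
    (A : Matrix (Fin n) (Fin n) ℝ)
    (hsym : A.IsSymm)
    (h01 : ∀ i j, A i j = 0 ∨ A i j = 1)
    (hdiag : ∀ i, A i i = 0)
    (hrow : ∀ i, ∑ j, A i j = (d : ℝ))
    (Ψx Ψy Ψz : ℝ) (hΨx : 0 ≤ Ψx) (hΨy : 0 ≤ Ψy) (hΨz : 0 ≤ Ψz)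
    (M : Matrix (Fin n ⊕ Fin n) (Fin n ⊕ Fin n) ℝ)
    (hM : M = Matrix.fromBlocks
      ((-(γ + α)) • (1 : Matrix (Fin n) (Fin n) ℝ) + (r * Ψz / kmax) • A)
      ((-γ) • (1 : Matrix (Fin n) (Fin n) ℝ) - (σ * Ψx / kmax) • A)
      ((-γ) • (1 : Matrix (Fin n) (Fin n) ℝ) - (σ * Ψy / kmax) • A)
      ((-(γ + α)) • (1 : Matrix (Fin n) (Fin n) ℝ) + (r * Ψz / kmax) • A))
    (h1 : r * Ψz * d / kmax + σ * Ψx * d / kmax < α)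
    (h2 : σ * Ψy * d / kmax + r * Ψz * d / kmax < α) :
    ∀ z ∈ spectrum ℂ (M.map (algebraMap ℝ ℂ)), z.re < 0 := by
  intro z hz
  rw [← Matrix.spectrum_toLin', ← Module.End.hasEigenvalue_iff_mem_spectrum] at hz
  obtain ⟨k, hk⟩ := eigenvalue_mem_ball hz
  have hK : (0 : ℝ) ≤ kmax := Nat.cast_nonneg _
  have ha : 0 ≤ r * Ψz / kmax := by positivity
  have hx : 0 ≤ σ * Ψx / kmax := by positivity
  have hy : 0 ≤ σ * Ψy / kmax := by positivity
  have key : M k k = -(γ + α) ∧ ∑ j, |M k j| < 2 * (γ + α) := by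
    have ra := fun i => abs_row_le A h01 hrow (-(γ + α)) (r * Ψz / kmax) i
    have rx := fun i => abs_row_le A h01 hrow (-γ) (-(σ * Ψx / kmax)) i
    have ry := fun i => abs_row_le A h01 hrow (-γ) (-(σ * Ψy / kmax)) i
    simp only [abs_neg, abs_of_pos hγ, abs_of_pos (add_pos hγ hα), abs_of_nonneg ha,
      abs_of_nonneg hx, abs_of_nonneg hy, neg_smul _ A, ← sub_eq_add_neg] at ra rx ry
    have e1 : r * Ψz * d / kmax = r * Ψz / kmax * d := by ring
    have e2 : σ * Ψx * d / kmax = σ * Ψx / kmax * d := by ring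
    have e3 : σ * Ψy * d / kmax = σ * Ψy / kmax * d := by ring
    rw [e1, e2] at h1
    rw [e1, e3] at h2
    subst hM
    rcases k with i | i
    · refine ⟨by simp [hdiag], ?_⟩
      rw [Fintype.sum_sum_type]
      simp only [Matrix.fromBlocks_apply₁₁, Matrix.fromBlocks_apply₁₂]
      linarith [ra i, rx i]
    · refine ⟨by simp [hdiag], ?_⟩
      rw [Fintype.sum_sum_type]
      simp only [Matrix.fromBlocks_apply₂₁, Matrix.fromBlocks_apply₂₂]
      linarith [ra i, ry i]
  obtain ⟨hkk, hsum⟩ := key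
  rw [← Finset.add_sum_erase _ _ (Finset.mem_univ k), hkk, abs_neg,
    abs_of_pos (add_pos hγ hα)] at hsum
  rw [mem_closedBall_iff_norm] at hk
  have hre := (Complex.re_le_norm _).trans hk
  simp only [Matrix.map_apply, hkk, Complex.coe_algebraMap, Complex.norm_real,
    Complex.sub_re, Complex.ofReal_re, Real.norm_eq_abs] at hre
  linarith
end

section
/- Let Ψ > 0 and reals V > 0, K > 0 (K playing the role of the mean degree ⟨k⟩) be such that Ψᶻ := V/K − 2Ψ ≥ 0, and let M be the 2n×2n real block matrix M = [[ −(γ + α)·I + (r·Ψᶻ/k_max)·A , −γ·I − (σ·Ψ/k_max)·A ], [ −γ·I − (σ·Ψ/k_max)·A , −(γ + α)·I + (r·Ψᶻ/k_max)·A ]]. If σ < 2r − (r·V)/(K·Ψ) + (α·k_max)/(Ψ·d), then every complex eigenvalue of M has strictly negative real part. -/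
open Matrix

/-- Maximum-modulus (Gershgorin type) estimate for `-c + b A`. -/
lemma re_neg_of_eigen (n d : ℕ) (A : Matrix (Fin n) (Fin n) ℝ)
    (h01 : ∀ i j, A i j = 0 ∨ A i j = 1)
    (hrow : ∀ i, ∑ j, A i j = (d : ℝ)) (b c : ℝ) (hbc : |b| * d < c) (z : ℂ)
    (u : Fin n → ℂ) (hu : u ≠ 0)
    (h : ∀ i, z * u i = -(c : ℂ) * u i + (b : ℂ) * ∑ j, (A i j : ℂ) * u j) : z.re < 0 := by
  obtain ⟨i0, hi0⟩ := Function.ne_iff.mp hu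
  obtain ⟨i, -, hi⟩ := Finset.exists_max_image Finset.univ (fun i => ‖u i‖) ⟨i0, Finset.mem_univ _⟩
  have hpos : 0 < ‖u i‖ := lt_of_lt_of_le (norm_pos_iff.mpr hi0) (hi i0 (Finset.mem_univ _))
  have h1 : (z + c) * u i = (b : ℂ) * ∑ j, (A i j : ℂ) * u j := by
    linear_combination h i
  have h2 : ‖∑ j, (A i j : ℂ) * u j‖ ≤ d * ‖u i‖ := by
    rw [← hrow i, Finset.sum_mul]
    refine (norm_sum_le _ _).trans (Finset.sum_le_sum fun j _ => ?_)
    have hA : 0 ≤ A i j := by rcases h01 i j with h | h <;> rw [h]; norm_num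
    rw [norm_mul, Complex.norm_real, Real.norm_of_nonneg hA]
    exact mul_le_mul_of_nonneg_left (hi j (Finset.mem_univ _)) hA
  have h3 : ‖z + c‖ * ‖u i‖ ≤ (|b| * d) * ‖u i‖ := by
    rw [← norm_mul, h1, norm_mul, Complex.norm_real, Real.norm_eq_abs, mul_assoc]
    exact mul_le_mul_of_nonneg_left h2 (abs_nonneg b)
  have h4 : ‖z + c‖ ≤ |b| * d := le_of_mul_le_mul_right h3 hpos
  have h5 : (z + c).re ≤ ‖z + c‖ := Complex.re_le_norm _
  simp only [Complex.add_re, Complex.ofReal_re] at h5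
  linarith

/-- At a symmetric equilibrium, the bound σ < 2r − rV/(KΨ) + α·k_max/(Ψd) on the
cross-inhibitory signal guarantees all complex eigenvalues of the aggregated
first-moment system matrix have strictly negative real part. -/
theorem symmetric_structured_system_matrix_stable
    (γ r α σ : ℝ) (hγ : 0 < γ) (hr : 0 < r) (hα : 0 < α) (hσ : 0 < σ)
    (n d kmax : ℕ) (hn : 1 ≤ n) (hd : 1 ≤ d) (hkmax : 1 ≤ kmax)
    (A : Matrix (Fin n) (Fin n) ℝ)
    (hsym : A.IsSymm)
    (h01 : ∀ i j, A i j = 0 ∨ A i j = 1)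
    (hdiag : ∀ i, A i i = 0)
    (hrow : ∀ i, ∑ j, A i j = (d : ℝ))
    (Ψ V K : ℝ) (hΨ : 0 < Ψ) (hV : 0 < V) (hK : 0 < K)
    (Ψz : ℝ) (hΨz : Ψz = V / K - 2 * Ψ) (hΨz0 : 0 ≤ Ψz)
    (M : Matrix (Fin n ⊕ Fin n) (Fin n ⊕ Fin n) ℝ)
    (hM : M = Matrix.fromBlocks
      ((-(γ + α)) • (1 : Matrix (Fin n) (Fin n) ℝ) + (r * Ψz / kmax) • A)
      ((-γ) • (1 : Matrix (Fin n) (Fin n) ℝ) - (σ * Ψ / kmax) • A)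
      ((-γ) • (1 : Matrix (Fin n) (Fin n) ℝ) - (σ * Ψ / kmax) • A)
      ((-(γ + α)) • (1 : Matrix (Fin n) (Fin n) ℝ) + (r * Ψz / kmax) • A))
    (hσbound : σ < 2 * r - r * V / (K * Ψ) + α * kmax / (Ψ * d)) :
    ∀ z ∈ spectrum ℂ (M.map (algebraMap ℝ ℂ)), z.re < 0 := by
  intro z hz
  have hk : (0 : ℝ) < kmax := by exact_mod_cast hkmax
  have hd0 : (0 : ℝ) < d := by exact_mod_cast hd
  obtain ⟨a, ha⟩ : ∃ a, a = r * Ψz / kmax := ⟨_, rfl⟩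
  obtain ⟨s, hs⟩ : ∃ s, s = σ * Ψ / kmax := ⟨_, rfl⟩
  have ha0 : 0 ≤ a := by rw [ha]; positivity
  have hs0 : 0 ≤ s := by rw [hs]; positivity
  have key : (a + s) * d < α := by
    have e : α - (a + s) * d =
        (2 * r - r * V / (K * Ψ) + α * kmax / (Ψ * d) - σ) * (Ψ * d / kmax) := by
      rw [ha, hs, hΨz]; field_simp; ring
    have : 0 < α - (a + s) * d := by
      rw [e]; exact mul_pos (sub_pos.mpr hσbound) (by positivity)
    linarith
  rw [← ha, ← hs] at hM
  rw [spectrum.mem_iff, Matrix.isUnit_iff_isUnit_det, isUnit_iff_ne_zero, not_not,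
    ← Matrix.exists_mulVec_eq_zero_iff] at hz
  obtain ⟨v, hv, hv0⟩ := hz
  have hE : ∀ i, z * v i = ((M.map (algebraMap ℝ ℂ)) *ᵥ v) i := by
    intro i
    have := congrFun hv0 i
    rw [Matrix.sub_mulVec, Algebra.algebraMap_eq_smul_one, Matrix.smul_mulVec,
      Matrix.one_mulVec] at this
    simpa [sub_eq_zero] using this
  have hone : ∀ (i : Fin n) (f : Fin n → ℂ),
      ∑ j, (((1 : Matrix (Fin n) (Fin n) ℝ) i j : ℝ) : ℂ) * f j = f i := by
    intro i f
    simp only [Matrix.one_apply, apply_ite Complex.ofReal, Complex.ofReal_one, Complex.ofReal_zero]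
    simp
  have hL : ∀ i, z * v (Sum.inl i) = -((γ + α : ℝ) : ℂ) * v (Sum.inl i)
      + (a : ℂ) * ∑ j, (A i j : ℂ) * v (Sum.inl j) - (γ : ℂ) * v (Sum.inr i)
      - (s : ℂ) * ∑ j, (A i j : ℂ) * v (Sum.inr j) := by
    intro i
    rw [hE, hM, ← hone i (fun j => v (Sum.inl j)), ← hone i (fun j => v (Sum.inr j))]
    simp only [Matrix.mulVec, dotProduct, Fintype.sum_sum_type, Matrix.map_apply,
      Matrix.fromBlocks_apply₁₁, Matrix.fromBlocks_apply₁₂, Matrix.add_apply, Matrix.sub_apply,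
      Matrix.smul_apply, smul_eq_mul, Complex.coe_algebraMap, Finset.mul_sum,
      ← Finset.sum_add_distrib, ← Finset.sum_sub_distrib]
    refine Finset.sum_congr rfl fun j _ => ?_
    push_cast
    ring
  have hR : ∀ i, z * v (Sum.inr i) = -((γ + α : ℝ) : ℂ) * v (Sum.inr i)
      + (a : ℂ) * ∑ j, (A i j : ℂ) * v (Sum.inr j) - (γ : ℂ) * v (Sum.inl i)
      - (s : ℂ) * ∑ j, (A i j : ℂ) * v (Sum.inl j) := by
    intro i
    rw [hE, hM, ← hone i (fun j => v (Sum.inl j)), ← hone i (fun j => v (Sum.inr j))]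
    simp only [Matrix.mulVec, dotProduct, Fintype.sum_sum_type, Matrix.map_apply,
      Matrix.fromBlocks_apply₂₁, Matrix.fromBlocks_apply₂₂, Matrix.add_apply, Matrix.sub_apply,
      Matrix.smul_apply, smul_eq_mul, Complex.coe_algebraMap, Finset.mul_sum,
      ← Finset.sum_add_distrib, ← Finset.sum_sub_distrib]
    refine Finset.sum_congr rfl fun j _ => ?_
    push_cast
    ring
  by_cases hw : (fun i => v (Sum.inl i) - v (Sum.inr i)) = 0
  · have hu : (fun i => v (Sum.inl i) + v (Sum.inr i)) ≠ 0 := by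
      intro hu
      apply hv
      funext i
      have e1 : ∀ i, v (Sum.inl i) - v (Sum.inr i) = 0 := fun i => congrFun hw i
      have e2 : ∀ i, v (Sum.inl i) + v (Sum.inr i) = 0 := fun i => congrFun hu i
      rcases i with i | i
      · change v (Sum.inl i) = 0
        linear_combination (e1 i + e2 i) / 2
      · change v (Sum.inr i) = 0
        linear_combination (e2 i - e1 i) / 2
    refine re_neg_of_eigen n d A h01 hrow (a - s) (2 * γ + α) ?_ z _ hu fun i => ?_
    · have : |a - s| ≤ a + s := abs_le.mpr ⟨by linarith, by linarith⟩
      have := mul_le_mul_of_nonneg_right this hd0.le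
      linarith
    · simp only [mul_add, Finset.sum_add_distrib]
      have h1 := hL i
      have h2 := hR i
      push_cast at h1 h2 ⊢
      linear_combination h1 + h2
  · refine re_neg_of_eigen n d A h01 hrow (a + s) α ?_ z _ hw fun i => ?_
    · rwa [abs_of_nonneg (by linarith)]
    · simp only [mul_sub, Finset.sum_sub_distrib]
      have h1 := hL i
      have h2 := hR i
      push_cast at h1 h2 ⊢
      linear_combination h1 - h2
end

section
/- Let P : {1,…,k_max} → ℝ be nonnegative with Σₖ P(k) = 1 and K := Σₖ k·P(k) > 0, and set ψₖ = k/k_max. Suppose x_i^k, y_i^k : ℝ → ℝ (for 1 ≤ i ≤ n, 1 ≤ k ≤ k_max) are differentiable functions satisfying, for all t, (x_i^k)'(t) = (1 − x_i^k − y_i^k)·(r·ψₖ·Σⱼ Aᵢⱼ θⱼˣ + γ) − x_i^k·(α + σ·ψₖ·Σⱼ Aᵢⱼ θⱼʸ) and (y_i^k)'(t) = (1 − x_i^k − y_i^k)·(r·ψₖ·Σⱼ Aᵢⱼ θⱼʸ + γ) − y_i^k·(α + σ·ψₖ·Σⱼ Aᵢⱼ θⱼˣ), where θᵢˣ = (1/K)·Σₖ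 k·P(k)·x_i^k and θᵢʸ = (1/K)·Σₖ k·P(k)·y_i^k. Then the aggregated variables satisfy, for all t and all i, (θᵢˣ)'(t) = (−γ − α)·θᵢˣ − γ·θᵢʸ + (r·Ψᵢᶻ/k_max)·Σⱼ Aᵢⱼ θⱼˣ − (σ·Ψᵢˣ/k_max)·Σⱼ Aᵢⱼ θⱼʸ + γ, where Ψᵢˣ = (1/K)·Σₖ k²·P(k)·x_i^k and Ψᵢᶻ = (1/K)·Σₖ k²·P(k)·(1 − x_i^k − y_i^k), and the analogous equation holds for (θᵢʸ)' with the roles of x and y interchanged. -/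
theorem aggregate_aux (γ r α σ M S T K : ℝ) (m : ℕ) (c P u v z : Fin m → ℝ)
    (hz : ∀ k, z k = 1 - u k - v k)
    (hK : K = ∑ k, c k * P k) (hKpos : 0 < K) :
    (1 / K) * ∑ k, c k * P k * (z k * (r * (c k / M) * S + γ)
        - u k * (α + σ * (c k / M) * T)) =
      (-γ - α) * ((1 / K) * ∑ k, c k * P k * u k) - γ * ((1 / K) * ∑ k, c k * P k * v k)
        + (r * ((1 / K) * ∑ k, c k ^ 2 * P k * z k) / M) * S
        - (σ * ((1 / K) * ∑ k, c k ^ 2 * P k * u k) / M) * T + γ := by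
  have hg : γ = (1 / K) * (∑ k, c k * P k) * γ := by
    rw [← hK]; field_simp
  have key : ∑ k, c k * P k * (z k * (r * (c k / M) * S + γ)
        - u k * (α + σ * (c k / M) * T)) =
      (-γ - α) * (∑ k, c k * P k * u k) - γ * (∑ k, c k * P k * v k)
        + (r * (∑ k, c k ^ 2 * P k * z k) / M) * S
        - (σ * (∑ k, c k ^ 2 * P k * u k) / M) * T + (∑ k, c k * P k) * γ := by
    simp only [Finset.mul_sum, Finset.sum_mul, Finset.sum_div, ← Finset.sum_add_distrib,
      ← Finset.sum_sub_distrib]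
    refine Finset.sum_congr rfl fun k _ => ?_
    rw [hz k]; ring
  rw [key]
  linear_combination -hg

/-- Aggregating the cluster dynamics of the structured networked multi-population
yields the first-moment dynamics for θᵢˣ and θᵢʸ. Clusters are indexed by
`k : Fin kmax`, the corresponding node degree being `(k : ℕ) + 1 ∈ {1,…,kmax}`. -/
theorem aggregated_theta_dynamics
    (γ r α σ : ℝ) (hγ : 0 < γ) (hr : 0 < r) (hα : 0 < α) (hσ : 0 < σ)
    (n d kmax : ℕ) (hn : 1 ≤ n) (hd : 1 ≤ d) (hkmax : 1 ≤ kmax)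
    (A : Matrix (Fin n) (Fin n) ℝ)
    (hsym : A.IsSymm)
    (h01 : ∀ i j, A i j = 0 ∨ A i j = 1)
    (hdiag : ∀ i, A i i = 0)
    (hrow : ∀ i, ∑ j, A i j = (d : ℝ))
    (P : Fin kmax → ℝ) (hP : ∀ k, 0 ≤ P k) (hPsum : ∑ k, P k = 1)
    (K : ℝ) (hK : K = ∑ k : Fin kmax, (((k : ℕ) + 1 : ℝ)) * P k) (hKpos : 0 < K)
    (x y : ℝ → Fin n → Fin kmax → ℝ)
    (θx θy : ℝ → Fin n → ℝ)
    (hθx : ∀ t i, θx t i = (1 / K) * ∑ k : Fin kmax, (((k : ℕ) + 1 : ℝ)) * P k * x t i k)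
    (hθy : ∀ t i, θy t i = (1 / K) * ∑ k : Fin kmax, (((k : ℕ) + 1 : ℝ)) * P k * y t i k)
    (Ψx Ψy Ψz : ℝ → Fin n → ℝ)
    (hΨx : ∀ t i, Ψx t i = (1 / K) * ∑ k : Fin kmax, (((k : ℕ) + 1 : ℝ)) ^ 2 * P k * x t i k)
    (hΨy : ∀ t i, Ψy t i = (1 / K) * ∑ k : Fin kmax, (((k : ℕ) + 1 : ℝ)) ^ 2 * P k * y t i k)
    (hΨz : ∀ t i, Ψz t i = (1 / K) * ∑ k : Fin kmax,
      (((k : ℕ) + 1 : ℝ)) ^ 2 * P k * (1 - x t i k - y t i k))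
    (hx : ∀ (t : ℝ) (i : Fin n) (k : Fin kmax), HasDerivAt (fun s => x s i k)
      ((1 - x t i k - y t i k) * (r * ((((k : ℕ) + 1 : ℝ)) / kmax) * ∑ j, A i j * θx t j + γ)
        - x t i k * (α + σ * ((((k : ℕ) + 1 : ℝ)) / kmax) * ∑ j, A i j * θy t j)) t)
    (hy : ∀ (t : ℝ) (i : Fin n) (k : Fin kmax), HasDerivAt (fun s => y s i k)
      ((1 - x t i k - y t i k) * (r * ((((k : ℕ) + 1 : ℝ)) / kmax) * ∑ j, A i j * θy t j + γ)
        - y t i k * (α + σ * ((((k : ℕ) + 1 : ℝ)) / kmax) * ∑ j, A i j * θx t j)) t) :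
    ∀ (t : ℝ) (i : Fin n),
      HasDerivAt (fun s => θx s i)
        ((-γ - α) * θx t i - γ * θy t i
          + (r * Ψz t i / kmax) * ∑ j, A i j * θx t j
          - (σ * Ψx t i / kmax) * ∑ j, A i j * θy t j + γ) t ∧
      HasDerivAt (fun s => θy s i)
        ((-γ - α) * θy t i - γ * θx t i
          + (r * Ψz t i / kmax) * ∑ j, A i j * θy t j
          - (σ * Ψy t i / kmax) * ∑ j, A i j * θx t j + γ) t := by
  intro t i
  constructor
  · have e : (fun s => θx s i) = fun s => (1 / K) * ∑ k : Fin kmax,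
        (((k : ℕ) + 1 : ℝ)) * P k * x s i k := funext fun s => hθx s i
    have h := (HasDerivAt.fun_sum (u := Finset.univ) fun k _ =>
      (hx t i k).const_mul ((((k : ℕ) + 1 : ℝ)) * P k)).const_mul (1 / K)
    rw [aggregate_aux γ r α σ kmax _ _ K kmax (fun k => ((k : ℕ) + 1 : ℝ)) P (x t i) (y t i)
      (fun k => 1 - x t i k - y t i k) (fun k => rfl) hK hKpos] at h
    rw [e, hθx t i, hθy t i, hΨz, hΨx]
    exact h
  · have e : (fun s => θy s i) = fun s => (1 / K) * ∑ k : Fin kmax,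
        (((k : ℕ) + 1 : ℝ)) * P k * y s i k := funext fun s => hθy s i
    have h := (HasDerivAt.fun_sum (u := Finset.univ) fun k _ =>
      (hy t i k).const_mul ((((k : ℕ) + 1 : ℝ)) * P k)).const_mul (1 / K)
    rw [aggregate_aux γ r α σ kmax _ _ K kmax (fun k => ((k : ℕ) + 1 : ℝ)) P (y t i) (x t i)
      (fun k => 1 - x t i k - y t i k) (fun k => by ring) hK hKpos] at h
    rw [e, hθx t i, hθy t i, hΨz, hΨy]
    exact h
end

section
/- Suppose additionally b > 0 (where b plays the role of d·θ) and α/γ > σ/r. Then the function ψ ↦ (r·ψ·b + γ) / ((2r + σ)·ψ·b + 2γ + α) is strictly monotonically increasing on [0, ∞); that is, the equilibrium committed fraction x* of a cluster is strictly increasing in its connectivity ψ. -/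
/-- If α/γ > σ/r, the equilibrium committed fraction
x*(ψ) = (rψb+γ)/((2r+σ)ψb+2γ+α) is strictly increasing in the connectivity ψ. -/
theorem equilibrium_fraction_increasing_in_connectivity
    (γ r α σ b : ℝ) (hγ : 0 < γ) (hr : 0 < r) (hα : 0 < α) (hσ : 0 < σ)
    (hb : 0 < b) (hratio : σ / r < α / γ) :
    StrictMonoOn (fun ψ : ℝ => (r * ψ * b + γ) / ((2 * r + σ) * ψ * b + 2 * γ + α))
      (Set.Ici (0 : ℝ)) := by
  intro x hx y hy hxy
  have hx0 : 0 ≤ x := hx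
  have hy0 : 0 ≤ y := hy
  rw [div_lt_div_iff₀ hr hγ] at hratio
  have key : 0 < b * (y - x) * (α * r - σ * γ) :=
    mul_pos (mul_pos hb (sub_pos.mpr hxy)) (sub_pos.mpr hratio)
  show (r * x * b + γ) / ((2 * r + σ) * x * b + 2 * γ + α)
    < (r * y * b + γ) / ((2 * r + σ) * y * b + 2 * γ + α)
  rw [div_lt_div_iff₀ (by positivity) (by positivity)]
  linarith
end

section
/- Let c ≥ 0, let B = [[ −(r + σ)·c − α − γ , −r·c − γ ], [ −r·c − γ , −(r + σ)·c − α − γ ]], let v = (r·c + γ, r·c + γ) ∈ ℝ², and let x* = (r·c + γ) / ((2r + σ)·c + 2γ + α). Then for every differentiable function u : ℝ → ℝ² satisfying u'(t) = B·u(t) + v for all t ≥ 0, one has u(t) → (x*, x*) as t → ∞; i.e., the equilibrium (x*, x*) of the affine cluster dynamics is globally asymptotically stable. -/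
open Matrix Filter

/-- Solutions of `f' = -k f` on `[0, ∞)` with `k > 0` tend to zero. -/
lemma scalar_decay (k : ℝ) (hk : 0 < k) (f : ℝ → ℝ)
    (hf : ∀ t : ℝ, 0 ≤ t → HasDerivAt f (-k * f t) t) :
    Tendsto f atTop (nhds 0) := by
  have hg : ∀ t : ℝ, 0 ≤ t → HasDerivAt (fun s => Real.exp (k * s) * f s) 0 t := by
    intro t ht
    have h1 : HasDerivAt (fun s : ℝ => Real.exp (k * s)) (Real.exp (k * t) * (k * 1)) t :=
      ((hasDerivAt_id t).const_mul k).exp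
    exact (h1.mul (hf t ht)).congr_deriv (by ring)
  have hconst : ∀ t : ℝ, 0 ≤ t → Real.exp (k * t) * f t = f 0 := by
    intro t ht
    have h := constant_of_has_deriv_right_zero (a := 0) (b := t)
      (f := fun s => Real.exp (k * s) * f s)
      (fun s hs => (hg s hs.1).continuousAt.continuousWithinAt)
      (fun s hs => (hg s hs.1).hasDerivWithinAt) t ⟨ht, le_refl t⟩
    simpa using h
  have heq : (fun t => Real.exp (-(k * t)) * f 0) =ᶠ[atTop] f := by
    filter_upwards [eventually_ge_atTop (0 : ℝ)] with t ht
    rw [← hconst t ht, ← mul_assoc, ← Real.exp_add]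
    simp
  refine Tendsto.congr' heq ?_
  have h2 : Tendsto (fun t : ℝ => k * t) atTop atTop := tendsto_id.const_mul_atTop hk
  have h3 := (Real.tendsto_exp_neg_atTop_nhds_zero.comp h2).mul_const (f 0)
  simpa using h3

/-- The equilibrium (x*, x*) of the affine cluster dynamics u' = B u + v is
globally asymptotically stable: every solution converges to it as t → ∞. -/
theorem cluster_dynamics_global_asymptotic_stability
    (γ r α σ : ℝ) (hγ : 0 < γ) (hr : 0 < r) (hα : 0 < α) (hσ : 0 < σ)
    (c : ℝ) (hc : 0 ≤ c)
    (B : Matrix (Fin 2) (Fin 2) ℝ)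
    (hB : B = !![-(r + σ) * c - α - γ, -r * c - γ;
                 -r * c - γ, -(r + σ) * c - α - γ])
    (v : Fin 2 → ℝ) (hv : v = ![r * c + γ, r * c + γ])
    (xstar : ℝ) (hx : xstar = (r * c + γ) / ((2 * r + σ) * c + 2 * γ + α))
    (u : ℝ → Fin 2 → ℝ)
    (hu : ∀ t : ℝ, 0 ≤ t → HasDerivAt u (B.mulVec (u t) + v) t) :
    Tendsto u atTop (nhds ![xstar, xstar]) := by
  have hD : 0 < (2 * r + σ) * c + 2 * γ + α := by positivity
  have hE : 0 < σ * c + α := by positivity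
  have hxD : xstar * ((2 * r + σ) * c + 2 * γ + α) = r * c + γ := by
    rw [hx]; field_simp
  have h0 : ∀ t : ℝ, 0 ≤ t → HasDerivAt (fun s => u s 0)
      ((-(r + σ) * c - α - γ) * u t 0 + (-r * c - γ) * u t 1 + (r * c + γ)) t := by
    intro t ht
    refine ((hasDerivAt_pi.1 (hu t ht)) 0).congr_deriv ?_
    simp [hB, hv, Matrix.mulVec, dotProduct, Fin.sum_univ_two]
  have h1 : ∀ t : ℝ, 0 ≤ t → HasDerivAt (fun s => u s 1)
      ((-r * c - γ) * u t 0 + (-(r + σ) * c - α - γ) * u t 1 + (r * c + γ)) t := by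
    intro t ht
    refine ((hasDerivAt_pi.1 (hu t ht)) 1).congr_deriv ?_
    simp [hB, hv, Matrix.mulVec, dotProduct, Fin.sum_univ_two]
  have hs := scalar_decay _ hD (fun s => u s 0 + u s 1 - 2 * xstar) (fun t ht =>
    (((h0 t ht).add (h1 t ht)).sub_const (2 * xstar)).congr_deriv
      (by linear_combination (-2) * hxD))
  have hd := scalar_decay _ hE (fun s => u s 0 - u s 1) (fun t ht =>
    ((h0 t ht).sub (h1 t ht)).congr_deriv (by ring))
  rw [tendsto_pi_nhds]
  intro i
  fin_cases i
  · have h := ((hs.add hd).div_const 2).add_const xstar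
    refine (h.congr (fun t => ?_)).trans (by simp)
    simp only [Fin.zero_eta]
    ring
  · have h := ((hs.sub hd).div_const 2).add_const xstar
    refine (h.congr (fun t => ?_)).trans (by simp)
    simp only [Fin.mk_one]
    ring
end
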